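/- arXiv:2510.01580 — 5 statements merged into one kernel-verified Lean document; each statement's English description precedes it below -/
import Mathlib

section
/- If the interval [t₀, t_d) is (ε,w)-defected, then every row sum of Φ(t_d, t₀) is at most 1 − ε w^δ, where δ := t_d − t₀; consequently ‖Φ(t_d, t₀)‖ ≤ 1 − ε w^δ in the maximum absolute row-sum norm. -/
open Matrix Finset Filter

noncomputable section

/-- Maximum absolute row-sum norm of a matrix. -/
noncomputable def rowNorm {n : ℕ} (A : Matrix (Fin n) (Fin n) ℝ) : ℝ :=
  ⨆ i, ∑ j, |A i j|

/-- Auxiliary product: `PhiAux lam W τ k = Λ(τ+k-1)W(τ+k-1) ⋯ Λ(τ)W(τ)`. -/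
noncomputable def PhiAux {n : ℕ} (lam : ℕ → Fin n → ℝ)
    (W : ℕ → Matrix (Fin n) (Fin n) ℝ) (τ : ℕ) : ℕ → Matrix (Fin n) (Fin n) ℝ
  | 0 => 1
  | k + 1 => (Matrix.diagonal (lam (τ + k)) * W (τ + k)) * PhiAux lam W τ k

/-- State-transition matrix `Φ(t,τ) = Λ(t−1)W(t−1) ⋯ Λ(τ)W(τ)`, `Φ(τ,τ) = I`. -/
noncomputable def Phi {n : ℕ} (lam : ℕ → Fin n → ℝ)
    (W : ℕ → Matrix (Fin n) (Fin n) ℝ) (t τ : ℕ) : Matrix (Fin n) (Fin n) ℝ :=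
  PhiAux lam W τ (t - τ)

/-- The interval `[t0, td)` is `(ε,w)`-defected: every agent `i` is reached by an
influential temporal path from an `ε`-stubborn source. -/
def IsDefected {n : ℕ} (lam : ℕ → Fin n → ℝ) (W : ℕ → Matrix (Fin n) (Fin n) ℝ)
    (ε w : ℝ) (t0 td : ℕ) : Prop :=
  ∀ i : Fin n, ∃ τ : ℕ, t0 ≤ τ ∧ τ < td ∧ ∃ a : ℕ → Fin n, a td = i ∧
    lam τ (a (τ + 1)) ≤ 1 - ε ∧
    ∀ k, τ + 1 ≤ k → k + 1 ≤ td → w ≤ W k (a (k + 1)) (a k)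

theorem PhiAux_nonneg {n : ℕ} {lam : ℕ → Fin n → ℝ} {W : ℕ → Matrix (Fin n) (Fin n) ℝ}
    (hW0 : ∀ t i j, 0 ≤ W t i j) (hlam : ∀ t i, 0 ≤ lam t i) (τ k : ℕ) (i j : Fin n) :
    0 ≤ PhiAux lam W τ k i j := by
  induction k generalizing i j with
  | zero =>
    rw [PhiAux, Matrix.one_apply]
    split_ifs <;> norm_num
  | succ k ih =>
    rw [PhiAux, Matrix.mul_apply]
    refine Finset.sum_nonneg fun l _ => mul_nonneg ?_ (ih l j)
    rw [Matrix.diagonal_mul]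
    exact mul_nonneg (hlam _ _) (hW0 _ _ _)

theorem sum_PhiAux_succ {n : ℕ} (lam : ℕ → Fin n → ℝ) (W : ℕ → Matrix (Fin n) (Fin n) ℝ)
    (τ k : ℕ) (i : Fin n) :
    ∑ j, PhiAux lam W τ (k + 1) i j =
      lam (τ + k) i * ∑ l, W (τ + k) i l * ∑ j, PhiAux lam W τ k l j := by
  simp only [PhiAux, Matrix.mul_apply (M := Matrix.diagonal _ * _), Matrix.diagonal_mul]
  rw [Finset.sum_comm]
  simp only [Finset.mul_sum, mul_assoc]

/-- A convex combination of numbers at most `1` with weight at least `w` on a number at most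
`1 - c` is at most `1 - w * c`. -/
theorem sum_mul_le_one_sub {ι : Type*} [Fintype ι] {p r : ι → ℝ} (hp0 : ∀ l, 0 ≤ p l)
    (hp1 : ∑ l, p l = 1) (hr : ∀ l, r l ≤ 1) {w c : ℝ} (hc : 0 ≤ c) {a : ι} (hw : w ≤ p a)
    (ha : r a ≤ 1 - c) : ∑ l, p l * r l ≤ 1 - w * c := by
  have hsingle : p a * (1 - r a) ≤ ∑ l, p l * (1 - r l) :=
    Finset.single_le_sum (f := fun l => p l * (1 - r l))
      (fun l _ => mul_nonneg (hp0 l) (sub_nonneg.2 (hr l))) (Finset.mem_univ a)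
  have hsum : ∑ l, p l * (1 - r l) = 1 - ∑ l, p l * r l := by
    simp only [mul_sub, mul_one, Finset.sum_sub_distrib, hp1]
  have hlow : w * c ≤ p a * (1 - r a) :=
    mul_le_mul hw (by linarith) hc (hp0 a)
  linarith

theorem sum_PhiAux_le_one {n : ℕ} {lam : ℕ → Fin n → ℝ} {W : ℕ → Matrix (Fin n) (Fin n) ℝ}
    (hW0 : ∀ t i j, 0 ≤ W t i j) (hW1 : ∀ t i, ∑ j, W t i j = 1)
    (hlam : ∀ t i, 0 ≤ lam t i ∧ lam t i ≤ 1) (τ k : ℕ) (i : Fin n) :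
    ∑ j, PhiAux lam W τ k i j ≤ 1 := by
  induction k generalizing i with
  | zero => simp [PhiAux, Matrix.one_apply]
  | succ k ih =>
    rw [sum_PhiAux_succ]
    have hle : ∑ l, W (τ + k) i l * ∑ j, PhiAux lam W τ k l j ≤ 1 := by
      simpa using sum_mul_le_one_sub (hW0 (τ + k) i) (hW1 (τ + k) i) ih le_rfl
        (hW0 (τ + k) i i) (by simpa using ih i)
    exact mul_le_one₀ (hlam _ _).2 (Finset.sum_nonneg fun l _ => mul_nonneg (hW0 _ _ _)
      (Finset.sum_nonneg fun j _ => PhiAux_nonneg hW0 (fun t i => (hlam t i).1) _ _ _ _)) hle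

/-- The row-sum deficit created by an `ε`-stubborn agent at time `t0 + s` decays by at most a
factor `w` per step along an influential temporal path. -/
theorem sum_PhiAux_le_of_path {n : ℕ} {lam : ℕ → Fin n → ℝ}
    {W : ℕ → Matrix (Fin n) (Fin n) ℝ}
    (hW0 : ∀ t i j, 0 ≤ W t i j) (hW1 : ∀ t i, ∑ j, W t i j = 1)
    (hlam : ∀ t i, 0 ≤ lam t i ∧ lam t i ≤ 1) {ε w : ℝ} (hε : 0 ≤ ε) (hw : 0 ≤ w)
    (t0 s m : ℕ) (a : ℕ → Fin n) (hsrc : lam (t0 + s) (a (t0 + s + 1)) ≤ 1 - ε)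
    (hpath : ∀ k, t0 + s + 1 ≤ k → k + 1 ≤ t0 + s + 1 + m → w ≤ W k (a (k + 1)) (a k)) :
    ∑ j, PhiAux lam W t0 (s + 1 + m) (a (t0 + s + 1 + m)) j ≤ 1 - ε * w ^ m := by
  have hnonneg : ∀ t k i, 0 ≤ ∑ l, W t i l * ∑ j, PhiAux lam W t0 k l j := fun t k i =>
    Finset.sum_nonneg fun l _ => mul_nonneg (hW0 _ _ _)
      (Finset.sum_nonneg fun j _ => PhiAux_nonneg hW0 (fun t i => (hlam t i).1) _ _ _ _)
  have hrow := sum_PhiAux_le_one hW0 hW1 hlam t0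
  induction m with
  | zero =>
    simp only [add_zero, pow_zero, mul_one]
    rw [sum_PhiAux_succ]
    have hle : ∑ l, W (t0 + s) (a (t0 + s + 1)) l * ∑ j, PhiAux lam W t0 s l j ≤ 1 := by
      simpa using sum_mul_le_one_sub (hW0 (t0 + s) (a (t0 + s + 1))) (hW1 _ _) (hrow s) le_rfl
        (hW0 _ _ (a 0)) (by simpa using hrow s (a 0))
    exact (mul_le_of_le_one_right (hlam _ _).1 hle).trans hsrc
  | succ m ih =>
    have hprev := ih fun k hk hkm => hpath k hk (by omega)
    rw [← add_assoc, sum_PhiAux_succ, show t0 + (s + 1 + m) = t0 + s + 1 + m by ring]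
    refine (mul_le_of_le_one_left (hnonneg _ _ _) (hlam _ _).2).trans ?_
    refine (sum_mul_le_one_sub (hW0 _ _) (hW1 _ _) (hrow _) (by positivity)
      (hpath (t0 + s + 1 + m) (by omega) (by omega)) hprev).trans_eq ?_
    ring

/-- contraction bound for a defected interval. -/
theorem Phi_contraction_of_defected {n : ℕ} (hn : 1 ≤ n)
    (lam : ℕ → Fin n → ℝ) (W : ℕ → Matrix (Fin n) (Fin n) ℝ)
    (hW0 : ∀ t i j, 0 ≤ W t i j) (hW1 : ∀ t i, ∑ j, W t i j = 1)
    (hlam : ∀ t i, 0 ≤ lam t i ∧ lam t i ≤ 1)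
    (ε w : ℝ) (hε : 0 < ε ∧ ε < 1) (hw : 0 < w ∧ w < 1)
    (t0 td : ℕ) (htd : t0 < td)
    (hdef : IsDefected lam W ε w t0 td) :
    (∀ i, ∑ j, Phi lam W td t0 i j ≤ 1 - ε * w ^ (td - t0)) ∧
    rowNorm (Phi lam W td t0) ≤ 1 - ε * w ^ (td - t0) := by
  have hrows : ∀ i, ∑ j, Phi lam W td t0 i j ≤ 1 - ε * w ^ (td - t0) := by
    intro i
    obtain ⟨τ, hτ0, hτd, a, rfl, hsrc, hpath⟩ := hdef i
    obtain ⟨s, rfl⟩ := Nat.exists_eq_add_of_le hτ0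
    obtain ⟨m, rfl⟩ := Nat.exists_eq_add_of_le (Nat.succ_le_of_lt hτd)
    simp only [Nat.succ_eq_add_one] at hpath ⊢
    have hlen : t0 + s + 1 + m - t0 = s + 1 + m := by omega
    rw [Phi, hlen]
    refine (sum_PhiAux_le_of_path hW0 hW1 hlam hε.1.le hw.1.le t0 s m a hsrc hpath).trans ?_
    have hpow : w ^ (s + 1 + m) ≤ w ^ m :=
      pow_le_pow_of_le_one hw.1.le hw.2.le (Nat.le_add_left _ _)
    exact sub_le_sub_left (mul_le_mul_of_nonneg_left hpow hε.1.le) 1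
  refine ⟨hrows, ?_⟩
  have : Nonempty (Fin n) := ⟨⟨0, hn⟩⟩
  refine ciSup_le fun i => le_of_eq_of_le ?_ (hrows i)
  exact Finset.sum_congr rfl fun j _ =>
    abs_of_nonneg (PhiAux_nonneg hW0 (fun t i => (hlam t i).1) _ _ _ _)
end
end

section
/- Let t_1 < t_2 < ⋯ < t_d be times partitioning [t_1, t_d] into d−1 consecutive subintervals, and suppose that α of these subintervals are (ε,w)-defected, with lengths δ_1, …, δ_α. Then ‖Φ(t_d, t_1)‖ ≤ ∏_{a=1}^{α} (1 − ε w^{δ_a}) in the maximum absolute row-sum norm. -/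
open Matrix Finset Filter

noncomputable section

/-- Row sums of `Phi lam W t τ`. -/
def PhiRowSum {n : ℕ} (lam : ℕ → Fin n → ℝ) (W : ℕ → Matrix (Fin n) (Fin n) ℝ)
    (τ t : ℕ) (i : Fin n) : ℝ :=
  ∑ j, Phi lam W t τ i j

lemma Phi_self {n : ℕ} (lam : ℕ → Fin n → ℝ) (W : ℕ → Matrix (Fin n) (Fin n) ℝ) (τ : ℕ) :
    Phi lam W τ τ = 1 := by
  simp [Phi, PhiAux]

lemma Phi_succ {n : ℕ} (lam : ℕ → Fin n → ℝ) (W : ℕ → Matrix (Fin n) (Fin n) ℝ)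
    {τ t : ℕ} (h : τ ≤ t) :
    Phi lam W (t + 1) τ = Matrix.diagonal (lam t) * W t * Phi lam W t τ := by
  obtain ⟨k, rfl⟩ := Nat.exists_eq_add_of_le h
  have h₁ : τ + k + 1 - τ = k + 1 := by omega
  have h₂ : τ + k - τ = k := by omega
  simp only [Phi, h₁, h₂, PhiAux]

lemma Phi_succ_apply {n : ℕ} (lam : ℕ → Fin n → ℝ) (W : ℕ → Matrix (Fin n) (Fin n) ℝ)
    {τ t : ℕ} (h : τ ≤ t) (i j : Fin n) :
    Phi lam W (t + 1) τ i j = lam t i * ∑ l, W t i l * Phi lam W t τ l j := by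
  rw [Phi_succ lam W h, Matrix.mul_assoc, Matrix.diagonal_mul, Matrix.mul_apply]

lemma PhiRowSum_succ {n : ℕ} (lam : ℕ → Fin n → ℝ) (W : ℕ → Matrix (Fin n) (Fin n) ℝ)
    {τ t : ℕ} (h : τ ≤ t) (i : Fin n) :
    PhiRowSum lam W τ (t + 1) i = lam t i * ∑ l, W t i l * PhiRowSum lam W τ t l := by
  simp only [PhiRowSum, Phi_succ_apply lam W h, ← Finset.mul_sum]
  rw [Finset.sum_comm]
  simp only [Finset.mul_sum]

lemma Phi_nonneg {n : ℕ} {lam : ℕ → Fin n → ℝ} {W : ℕ → Matrix (Fin n) (Fin n) ℝ}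
    (hW0 : ∀ t i j, 0 ≤ W t i j) (hlam : ∀ t i, 0 ≤ lam t i) {τ t : ℕ} (h : τ ≤ t)
    (i j : Fin n) : 0 ≤ Phi lam W t τ i j := by
  induction t, h using Nat.le_induction generalizing i with
  | base =>
    rw [Phi_self, Matrix.one_apply]
    split_ifs <;> norm_num
  | succ t h ih =>
    rw [Phi_succ_apply lam W h]
    exact mul_nonneg (hlam t i) (Finset.sum_nonneg fun l _ => mul_nonneg (hW0 t i l) (ih l))

lemma PhiRowSum_nonneg {n : ℕ} {lam : ℕ → Fin n → ℝ} {W : ℕ → Matrix (Fin n) (Fin n) ℝ}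
    (hW0 : ∀ t i j, 0 ≤ W t i j) (hlam : ∀ t i, 0 ≤ lam t i) {τ t : ℕ} (h : τ ≤ t)
    (i : Fin n) : 0 ≤ PhiRowSum lam W τ t i :=
  Finset.sum_nonneg fun j _ => Phi_nonneg hW0 hlam h i j

/-- A weighted average of values at most `c` falls below `c` by at least each weighted deficit. -/
lemma sum_mul_le_sub_of_le {ι : Type*} [Fintype ι] {p x : ι → ℝ} {c : ℝ}
    (hp : ∀ i, 0 ≤ p i) (hp1 : ∑ i, p i = 1) (hx : ∀ i, x i ≤ c) (j : ι) :
    ∑ i, p i * x i ≤ c - p j * (c - x j) := by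
  have h : p j * (c - x j) ≤ ∑ i, p i * (c - x i) :=
    Finset.single_le_sum (f := fun i => p i * (c - x i))
      (fun i _ => mul_nonneg (hp i) (sub_nonneg.2 (hx i))) (Finset.mem_univ j)
  simp only [mul_sub, Finset.sum_sub_distrib, ← Finset.sum_mul, hp1, one_mul] at h ⊢
  linarith

section Contraction

variable {n : ℕ} {lam : ℕ → Fin n → ℝ} {W : ℕ → Matrix (Fin n) (Fin n) ℝ}

lemma PhiRowSum_succ_le_sub (hW0 : ∀ t i j, 0 ≤ W t i j) (hW1 : ∀ t i, ∑ j, W t i j = 1)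
    (hlam : ∀ t i, 0 ≤ lam t i ∧ lam t i ≤ 1) {τ t : ℕ} (h : τ ≤ t) {c : ℝ}
    (hc : ∀ i, PhiRowSum lam W τ t i ≤ c) (i j : Fin n) :
    PhiRowSum lam W τ (t + 1) i ≤ c - W t i j * (c - PhiRowSum lam W τ t j) := by
  rw [PhiRowSum_succ lam W h]
  refine le_trans (mul_le_of_le_one_left ?_ (hlam t i).2)
    (sum_mul_le_sub_of_le (hW0 t i) (hW1 t i) hc j)
  exact Finset.sum_nonneg fun l _ =>
    mul_nonneg (hW0 t i l) (PhiRowSum_nonneg hW0 (fun t i => (hlam t i).1) h l)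

lemma PhiRowSum_le_of_le (hW0 : ∀ t i j, 0 ≤ W t i j) (hW1 : ∀ t i, ∑ j, W t i j = 1)
    (hlam : ∀ t i, 0 ≤ lam t i ∧ lam t i ≤ 1) {τ t₀ t : ℕ} (h₀ : τ ≤ t₀) (h : t₀ ≤ t)
    {c : ℝ} (hc : ∀ i, PhiRowSum lam W τ t₀ i ≤ c) (i : Fin n) :
    PhiRowSum lam W τ t i ≤ c := by
  induction t, h using Nat.le_induction generalizing i with
  | base => exact hc i
  | succ t h ih =>
    exact (PhiRowSum_succ_le_sub hW0 hW1 hlam (h₀.trans h) ih i i).trans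
      (sub_le_self _ (mul_nonneg (hW0 t i i) (sub_nonneg.2 (ih i))))

/-- A defected interval contracts a uniform bound on the row sums. -/
lemma PhiRowSum_le_of_isDefected (hW0 : ∀ t i j, 0 ≤ W t i j)
    (hW1 : ∀ t i, ∑ j, W t i j = 1) (hlam : ∀ t i, 0 ≤ lam t i ∧ lam t i ≤ 1)
    {ε w : ℝ} (hε : 0 ≤ ε) (hw0 : 0 ≤ w) (hw1 : w ≤ 1) {τ t₀ t : ℕ} (h₀ : τ ≤ t₀)
    (hdef : IsDefected lam W ε w t₀ t) {c : ℝ} (hc0 : 0 ≤ c)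
    (hc : ∀ i, PhiRowSum lam W τ t₀ i ≤ c) (i : Fin n) :
    PhiRowSum lam W τ t i ≤ c * (1 - ε * w ^ (t - t₀)) := by
  obtain ⟨σ, hσ₀, hσ, a, rfl, hstub, hpath⟩ := hdef i
  have hle : ∀ s, t₀ ≤ s → ∀ i, PhiRowSum lam W τ s i ≤ c := fun s hs =>
    PhiRowSum_le_of_le hW0 hW1 hlam h₀ hs hc
  have hdeficit : ∀ s, σ + 1 ≤ s → s ≤ t →
      ε * c * w ^ (s - (σ + 1)) ≤ c - PhiRowSum lam W τ s (a s) := by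
    intro s hs
    induction s, hs using Nat.le_induction with
    | base =>
      intro _
      have hτσ : τ ≤ σ := h₀.trans hσ₀
      have havg : ∑ l, W σ (a (σ + 1)) l * PhiRowSum lam W τ σ l ≤ c :=
        (sum_mul_le_sub_of_le (hW0 σ _) (hW1 σ _) (hle σ hσ₀) (a σ)).trans
          (sub_le_self _ (mul_nonneg (hW0 _ _ _) (sub_nonneg.2 (hle σ hσ₀ _))))
      have h₁ := mul_le_mul_of_nonneg_left havg (hlam σ (a (σ + 1))).1
      have h₂ := mul_le_mul_of_nonneg_right hstub hc0
      rw [PhiRowSum_succ lam W hτσ, Nat.sub_self, pow_zero]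
      linarith
    | succ s hs ih =>
      intro hst
      have hs₀ : t₀ ≤ s := by omega
      have hstep := PhiRowSum_succ_le_sub hW0 hW1 hlam (h₀.trans hs₀) (hle s hs₀)
        (a (s + 1)) (a s)
      have h₁ := mul_le_mul_of_nonneg_right (hpath s hs hst) (sub_nonneg.2 (hle s hs₀ (a s)))
      have h₂ := mul_le_mul_of_nonneg_left (ih (by omega)) hw0
      rw [Nat.succ_sub hs, pow_succ]
      linarith
  have hpow : w ^ (t - t₀) ≤ w ^ (t - (σ + 1)) :=
    pow_le_pow_of_le_one hw0 hw1 (by omega)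
  have h₁ := mul_le_mul_of_nonneg_left hpow (mul_nonneg hε hc0)
  have h₂ := hdeficit t hσ le_rfl
  linarith

end Contraction

/-- product contraction bound over a partition containing defected
subintervals. -/
theorem Phi_contraction_of_partition {n : ℕ} (hn : 1 ≤ n)
    (lam : ℕ → Fin n → ℝ) (W : ℕ → Matrix (Fin n) (Fin n) ℝ)
    (hW0 : ∀ t i j, 0 ≤ W t i j) (hW1 : ∀ t i, ∑ j, W t i j = 1)
    (hlam : ∀ t i, 0 ≤ lam t i ∧ lam t i ≤ 1)
    (ε w : ℝ) (hε : 0 < ε ∧ ε < 1) (hw : 0 < w ∧ w < 1)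
    (d : ℕ) (ts : Fin (d + 1) → ℕ) (hmono : StrictMono ts)
    (S : Finset (Fin d))
    (hdef : ∀ j ∈ S, IsDefected lam W ε w (ts j.castSucc) (ts j.succ)) :
    rowNorm (Phi lam W (ts (Fin.last d)) (ts 0)) ≤
      ∏ j ∈ S, (1 - ε * w ^ (ts j.succ - ts j.castSucc)) := by
  have hfactor : ∀ j : Fin d, 0 ≤ 1 - ε * w ^ (ts j.succ - ts j.castSucc) := fun j =>
    sub_nonneg.2 (mul_le_one₀ hε.2.le (pow_nonneg hw.1.le _) (pow_le_one₀ hw.1.le hw.2.le))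
  have hbound : ∀ m : Fin (d + 1), ∀ i, PhiRowSum lam W (ts 0) (ts m) i ≤
      ∏ j ∈ S with j.castSucc < m, (1 - ε * w ^ (ts j.succ - ts j.castSucc)) := by
    intro m
    induction m using Fin.induction with
    | zero => intro i; simp [PhiRowSum, Phi_self, Matrix.one_apply]
    | succ m ih =>
      have h₀ : ts 0 ≤ ts m.castSucc := hmono.monotone (Fin.zero_le _)
      by_cases hm : m ∈ S
      · have hfilter : S.filter (fun j => j.castSucc < m.succ) =
            insert m (S.filter fun j => j.castSucc < m.castSucc) := by
          ext j
          simp only [Finset.mem_filter, Finset.mem_insert, Fin.castSucc_lt_succ_iff,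
            Fin.castSucc_lt_castSucc_iff, le_iff_eq_or_lt]
          grind
        rw [hfilter, Finset.prod_insert (by simp), mul_comm]
        exact PhiRowSum_le_of_isDefected hW0 hW1 hlam hε.1.le hw.1.le hw.2.le h₀ (hdef m hm)
          (Finset.prod_nonneg fun j _ => hfactor j) ih
      · have hfilter : S.filter (fun j => j.castSucc < m.succ) =
            S.filter fun j => j.castSucc < m.castSucc := by
          ext j
          simp only [Finset.mem_filter, Fin.castSucc_lt_succ_iff,
            Fin.castSucc_lt_castSucc_iff, le_iff_eq_or_lt]
          grind
        rw [hfilter]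
        exact PhiRowSum_le_of_le hW0 hW1 hlam h₀
          (hmono.monotone Fin.castSucc_lt_succ.le) ih
  have : Nonempty (Fin n) := ⟨⟨0, hn⟩⟩
  have hnonneg := Phi_nonneg hW0 (fun t i => (hlam t i).1)
    (hmono.monotone (Fin.zero_le (Fin.last d)))
  refine ciSup_le fun i => ?_
  simpa [PhiRowSum, abs_of_nonneg (hnonneg _ _), Fin.castSucc_lt_last] using
    hbound (Fin.last d) i
end
end

section
/- Suppose ‖Φ(t,0)‖ → 0 as t → ∞, and let x satisfy the TVFJ update x(t+1) = Λ(t)W(t)x(t) + (I − Λ(t))s with arbitrary initial condition x(0) ∈ ℝⁿ. Then every accumulation point y of the sequence (x(t))_{t∈ℕ} (i.e., every y ∈ ℝⁿ with y = lim_{k→∞} x(t_k) along some strictly increasing time sequence t_k) satisfies min_j s_j ≤ y_i ≤ max_j s_j for every coordinate i; that is, all ω-limit points lie in the convex hull of the innate opinions. -/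
open Matrix Finset Filter

noncomputable section

/-- Entries of `A *ᵥ v` are controlled by the row-sum norm of `A`. -/
lemma abs_mulVec_apply_le_rowNorm {n : ℕ} (A : Matrix (Fin n) (Fin n) ℝ) (v : Fin n → ℝ)
    (i : Fin n) : |(A *ᵥ v) i| ≤ rowNorm A * ‖v‖ := by
  have hrow : ∑ j, |A i j| ≤ rowNorm A :=
    le_ciSup (f := fun i => ∑ j, |A i j|) (Set.finite_range _).bddAbove i
  calc |(A *ᵥ v) i| ≤ ∑ j, |A i j * v j| := by
        simpa [Matrix.mulVec, dotProduct] using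
          Finset.abs_sum_le_sum_abs (fun j => A i j * v j) Finset.univ
    _ ≤ ∑ j, |A i j| * ‖v‖ := by
        refine Finset.sum_le_sum fun j _ => ?_
        rw [abs_mul]
        exact mul_le_mul_of_nonneg_left (norm_le_pi_norm v j) (abs_nonneg _)
    _ = (∑ j, |A i j|) * ‖v‖ := by rw [Finset.sum_mul]
    _ ≤ rowNorm A * ‖v‖ := mul_le_mul_of_nonneg_right hrow (norm_nonneg _)

/-- The excess of the trajectory over an upper bound `M` of the innate opinions is dominated by
the homogeneous evolution of the initial excess. -/
lemma sub_le_Phi_mulVec {n : ℕ}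
    {lam : ℕ → Fin n → ℝ} {W : ℕ → Matrix (Fin n) (Fin n) ℝ}
    (hW0 : ∀ t i j, 0 ≤ W t i j) (hW1 : ∀ t i, ∑ j, W t i j = 1)
    (hlam : ∀ t i, 0 ≤ lam t i ∧ lam t i ≤ 1)
    {s : Fin n → ℝ} {x : ℕ → Fin n → ℝ}
    (hx : ∀ t, x (t + 1) =
      (Matrix.diagonal (lam t) * W t) *ᵥ x t + (1 - Matrix.diagonal (lam t)) *ᵥ s)
    {M : ℝ} (hM : ∀ j, s j ≤ M) (t : ℕ) (i : Fin n) :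
    x t i - M ≤ (Phi lam W t 0 *ᵥ fun j => x 0 j - M) i := by
  induction t generalizing i with
  | zero => simp [Phi, PhiAux]
  | succ t ih =>
    have hstep : Phi lam W (t + 1) 0 = (Matrix.diagonal (lam t) * W t) * Phi lam W t 0 := by
      simp [Phi, PhiAux]
    have hxi : x (t + 1) i = lam t i * ∑ j, W t i j * x t j + (1 - lam t i) * s i := by
      rw [hx, Pi.add_apply, Matrix.sub_mulVec, ← Matrix.mulVec_mulVec, Pi.sub_apply,
        Matrix.mulVec_diagonal, Matrix.mulVec_diagonal, Matrix.one_mulVec]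
      simp only [Matrix.mulVec, dotProduct]
      ring
    have hsum : ∑ j, W t i j * (x t j - M) = ∑ j, W t i j * x t j - M := by
      simp only [mul_sub, Finset.sum_sub_distrib, ← Finset.sum_mul, hW1, one_mul]
    have hle : ∑ j, W t i j * (x t j - M) ≤
        ∑ j, W t i j * (Phi lam W t 0 *ᵥ fun j => x 0 j - M) j :=
      Finset.sum_le_sum fun j _ => mul_le_mul_of_nonneg_left (ih j) (hW0 t i j)
    rw [hstep, ← Matrix.mulVec_mulVec, ← Matrix.mulVec_mulVec, Matrix.mulVec_diagonal, hxi]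
    change _ ≤ lam t i * ∑ j, W t i j * (Phi lam W t 0 *ᵥ fun j => x 0 j - M) j
    have hscaled := mul_le_mul_of_nonneg_left hle (hlam t i).1
    rw [hsum] at hscaled
    have hs := mul_le_mul_of_nonneg_left (hM i) (sub_nonneg.2 (hlam t i).2)
    linarith

/-- Accumulation points of the trajectory are bounded above by any upper bound of the innate
opinions. -/
lemma accumulation_le_of_forall_le {n : ℕ}
    {lam : ℕ → Fin n → ℝ} {W : ℕ → Matrix (Fin n) (Fin n) ℝ}
    (hW0 : ∀ t i j, 0 ≤ W t i j) (hW1 : ∀ t i, ∑ j, W t i j = 1)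
    (hlam : ∀ t i, 0 ≤ lam t i ∧ lam t i ≤ 1)
    (hstab : Filter.Tendsto (fun t => rowNorm (Phi lam W t 0)) Filter.atTop (nhds 0))
    {s : Fin n → ℝ} {x : ℕ → Fin n → ℝ}
    (hx : ∀ t, x (t + 1) =
      (Matrix.diagonal (lam t) * W t) *ᵥ x t + (1 - Matrix.diagonal (lam t)) *ᵥ s)
    {M : ℝ} (hM : ∀ j, s j ≤ M) {y : Fin n → ℝ} {tk : ℕ → ℕ} (htk : StrictMono tk)
    (hy : Filter.Tendsto (fun k => x (tk k)) Filter.atTop (nhds y)) (i : Fin n) :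
    y i ≤ M := by
  have hlim := ((hstab.comp htk.tendsto_atTop).mul_const ‖fun j => x 0 j - M‖)
  rw [zero_mul] at hlim
  refine sub_nonpos.1 (le_of_tendsto_of_tendsto' ((tendsto_pi_nhds.1 hy i).sub_const M) hlim
    fun k => ?_)
  exact (sub_le_Phi_mulVec hW0 hW1 hlam hx hM (tk k) i).trans
    ((le_abs_self _).trans (abs_mulVec_apply_le_rowNorm _ _ i))

/-- under asymptotic stability, every ω-limit point of the TVFJ
trajectory lies in the convex hull (coordinate-wise interval) of the innate
opinions. -/
theorem omega_limit_in_hull {n : ℕ} (hn : 1 ≤ n)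
    (lam : ℕ → Fin n → ℝ) (W : ℕ → Matrix (Fin n) (Fin n) ℝ)
    (hW0 : ∀ t i j, 0 ≤ W t i j) (hW1 : ∀ t i, ∑ j, W t i j = 1)
    (hlam : ∀ t i, 0 ≤ lam t i ∧ lam t i ≤ 1)
    (hstab : Filter.Tendsto (fun t => rowNorm (Phi lam W t 0)) Filter.atTop (nhds 0))
    (s : Fin n → ℝ) (x : ℕ → Fin n → ℝ)
    (hx : ∀ t, x (t + 1) =
      (Matrix.diagonal (lam t) * W t) *ᵥ x t + (1 - Matrix.diagonal (lam t)) *ᵥ s) :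
    ∀ y : Fin n → ℝ,
      (∃ tk : ℕ → ℕ, StrictMono tk ∧
        Filter.Tendsto (fun k => x (tk k)) Filter.atTop (nhds y)) →
      ∀ i : Fin n, (⨅ j, s j) ≤ y i ∧ y i ≤ ⨆ j, s j := by
  rintro y ⟨tk, htk, hy⟩ i
  refine ⟨?_, accumulation_le_of_forall_le hW0 hW1 hlam hstab hx
    (fun j => le_ciSup (Set.finite_range s).bddAbove j) htk hy i⟩
  have hxneg : ∀ t, (-x) (t + 1) =
      (Matrix.diagonal (lam t) * W t) *ᵥ (-x) t + (1 - Matrix.diagonal (lam t)) *ᵥ (-s) := by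
    intro t
    simp only [Pi.neg_apply, hx t, Matrix.mulVec_neg, neg_add]
  exact neg_le_neg_iff.1 (accumulation_le_of_forall_le hW0 hW1 hlam hstab hxneg
    (fun j => neg_le_neg (ciInf_le (Set.finite_range s).bddBelow j)) htk hy.neg i)
end
end

section
/- Let A(t) and E(t) be n×n real matrices for t ∈ ℕ, and let Φ_A(t,τ) := A(t−1)⋯A(τ) and Φ_{A+E}(t,τ) := (A(t−1)+E(t−1))⋯(A(τ)+E(τ)) denote the corresponding state-transition matrices (equal to I when t = τ). Suppose there exist c > 0 and γ ∈ (0,1) with ‖Φ_A(t,τ)‖ ≤ c·γ^{t−τ} for all t ≥ τ ≥ 0, and suppose ‖E(t)‖ ≤ ζ for all t, where ζ < −(γ/c)·ln γ. Then the perturbed system is exponentially stable: for all t ≥ τ ≥ 0, ‖Φ_{A+E}(t,τ)‖ ≤ c·(γ e^{cζ/γ})^{t−τ}, and γ e^{cζ/γ} < 1. -/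
open Matrix Finset Filter

noncomputable section

/-- Auxiliary product: `PhiGenAux A τ k = A(τ+k−1) ⋯ A(τ)`. -/
noncomputable def PhiGenAux {n : ℕ} (A : ℕ → Matrix (Fin n) (Fin n) ℝ) (τ : ℕ) :
    ℕ → Matrix (Fin n) (Fin n) ℝ
  | 0 => 1
  | k + 1 => A (τ + k) * PhiGenAux A τ k

/-- State-transition matrix `Φ_A(t,τ) = A(t−1) ⋯ A(τ)`, `Φ_A(τ,τ) = I`. -/
noncomputable def PhiGen {n : ℕ} (A : ℕ → Matrix (Fin n) (Fin n) ℝ) (t τ : ℕ) :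
    Matrix (Fin n) (Fin n) ℝ :=
  PhiGenAux A τ (t - τ)

section RowNorm

open scoped Matrix.Norms.Operator

/-- `rowNorm` is the `ℓ∞` operator norm of Mathlib. -/
lemma rowNorm_eq_norm {n : ℕ} (M : Matrix (Fin n) (Fin n) ℝ) : rowNorm M = ‖M‖ := by
  rw [Matrix.linfty_opNorm_def, Finset.sup_univ_eq_ciSup, NNReal.coe_iSup]
  simp [rowNorm]

lemma rowNorm_nonneg {n : ℕ} (M : Matrix (Fin n) (Fin n) ℝ) : 0 ≤ rowNorm M := by
  rw [rowNorm_eq_norm]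
  exact norm_nonneg M

lemma rowNorm_add_le {n : ℕ} (M N : Matrix (Fin n) (Fin n) ℝ) :
    rowNorm (M + N) ≤ rowNorm M + rowNorm N := by
  simp only [rowNorm_eq_norm]
  exact norm_add_le M N

lemma rowNorm_mul_le {n : ℕ} (M N : Matrix (Fin n) (Fin n) ℝ) :
    rowNorm (M * N) ≤ rowNorm M * rowNorm N := by
  simp only [rowNorm_eq_norm]
  exact Matrix.linfty_opNorm_mul M N

end RowNorm

/-- Splitting off the rightmost factor of a transition product. -/
lemma PhiGenAux_succ_right {n : ℕ} (A : ℕ → Matrix (Fin n) (Fin n) ℝ) (τ m : ℕ) :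
    PhiGenAux A τ (m + 1) = PhiGenAux A (τ + 1) m * A τ := by
  induction m with
  | zero => simp [PhiGenAux]
  | succ m ih =>
    rw [PhiGenAux, ih, PhiGenAux, Matrix.mul_assoc, Nat.add_right_comm τ 1 m, Nat.add_assoc τ m 1]

/-- Running the perturbed system for `k` steps and then the nominal one for `m` steps. -/
lemma rowNorm_PhiGenAux_mul_PhiGenAux_add_le {n : ℕ}
    {A E : ℕ → Matrix (Fin n) (Fin n) ℝ} {c γ ζ : ℝ} (hc : 0 ≤ c) (hγ : 0 ≤ γ)
    (hA : ∀ τ m, rowNorm (PhiGenAux A τ m) ≤ c * γ ^ m)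
    (hE : ∀ t, rowNorm (E t) ≤ ζ) (τ k m : ℕ) :
    rowNorm (PhiGenAux A (τ + k) m * PhiGenAux (fun t => A t + E t) τ k) ≤
      c * γ ^ m * (γ + c * ζ) ^ k := by
  induction k generalizing m with
  | zero => simpa [PhiGenAux] using hA τ m
  | succ k ih =>
    set P := PhiGenAux (fun t => A t + E t) τ k with hP
    have hζ : 0 ≤ ζ := (rowNorm_nonneg _).trans (hE 0)
    have hsplit : PhiGenAux A (τ + (k + 1)) m * PhiGenAux (fun t => A t + E t) τ (k + 1) =
        PhiGenAux A (τ + k) (m + 1) * P +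
          PhiGenAux A (τ + (k + 1)) m * (E (τ + k) * P) := by
      rw [PhiGenAux_succ_right A, PhiGenAux.eq_2 _ τ k, ← hP, Matrix.add_mul, Matrix.mul_add,
        Matrix.mul_assoc, Nat.add_assoc]
    have hnorm : rowNorm P ≤ c * (γ + c * ζ) ^ k := by simpa [PhiGenAux] using ih 0
    calc
      _ ≤ rowNorm (PhiGenAux A (τ + k) (m + 1) * P) +
          rowNorm (PhiGenAux A (τ + (k + 1)) m * (E (τ + k) * P)) := by
        rw [hsplit]
        exact rowNorm_add_le _ _
      _ ≤ c * γ ^ (m + 1) * (γ + c * ζ) ^ k +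
          c * γ ^ m * (ζ * (c * (γ + c * ζ) ^ k)) := by
        refine add_le_add (ih (m + 1)) ((rowNorm_mul_le _ _).trans ?_)
        refine mul_le_mul (hA _ _) ((rowNorm_mul_le _ _).trans ?_) (rowNorm_nonneg _)
          (by positivity)
        exact mul_le_mul (hE _) hnorm (rowNorm_nonneg _) hζ
      _ = c * γ ^ m * (γ + c * ζ) ^ (k + 1) := by ring

/-- robustness of exponential stability for discrete-time linear
time-varying systems under a uniform perturbation bound
`ζ < −(γ/c)·ln γ`: the perturbed transition matrices satisfy
`‖Φ_{A+E}(t,τ)‖ ≤ c·(γ e^{cζ/γ})^{t−τ}` with `γ e^{cζ/γ} < 1`. -/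
theorem perturbed_exponential_stability {n : ℕ} (hn : 1 ≤ n)
    (A E : ℕ → Matrix (Fin n) (Fin n) ℝ)
    (c γ : ℝ) (hc : 0 < c) (hγ : 0 < γ ∧ γ < 1)
    (hA : ∀ τ t : ℕ, τ ≤ t → rowNorm (PhiGen A t τ) ≤ c * γ ^ (t - τ))
    (ζ : ℝ) (hE : ∀ t, rowNorm (E t) ≤ ζ)
    (hζ : ζ < -(γ / c) * Real.log γ) :
    γ * Real.exp (c * ζ / γ) < 1 ∧
    ∀ τ t : ℕ, τ ≤ t →
      rowNorm (PhiGen (fun k => A k + E k) t τ) ≤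
        c * (γ * Real.exp (c * ζ / γ)) ^ (t - τ) := by
  obtain ⟨hγ0, -⟩ := hγ
  have hζ0 : 0 ≤ ζ := (rowNorm_nonneg _).trans (hE 0)
  refine ⟨?_, fun τ t _ => ?_⟩
  · have hlog : c * ζ / γ < -Real.log γ := by
      rw [div_lt_iff₀ hγ0]
      calc c * ζ < c * (-(γ / c) * Real.log γ) := mul_lt_mul_of_pos_left hζ hc
        _ = -Real.log γ * γ := by field_simp
    calc γ * Real.exp (c * ζ / γ) < γ * Real.exp (-Real.log γ) := by gcongr
      _ = 1 := by rw [Real.exp_neg, Real.exp_log hγ0, mul_inv_cancel₀ hγ0.ne']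
  · have hA' : ∀ σ m, rowNorm (PhiGenAux A σ m) ≤ c * γ ^ m := fun σ m => by
      simpa [PhiGen] using hA σ (σ + m) (Nat.le_add_right σ m)
    have hrate : γ + c * ζ ≤ γ * Real.exp (c * ζ / γ) :=
      calc γ + c * ζ = γ * (c * ζ / γ + 1) := by field_simp; ring
        _ ≤ γ * Real.exp (c * ζ / γ) := by gcongr; exact Real.add_one_le_exp _
    calc rowNorm (PhiGen (fun k => A k + E k) t τ) ≤ c * (γ + c * ζ) ^ (t - τ) := by
          simpa [PhiGen, PhiGenAux] using
            rowNorm_PhiGenAux_mul_PhiGenAux_add_le hc.le hγ0.le hA' hE τ (t - τ) 0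
      _ ≤ c * (γ * Real.exp (c * ζ / γ)) ^ (t - τ) := by gcongr
end
end

section
/- Let n = 3, let W(t) = W := (1/3)·J for all t, where J is the 3×3 all-ones matrix, and let Λ(t) = λ(t)·I with λ(t) := 1 − 1/(t+2)² for all t ∈ ℕ. Then for every t ≥ 1, Φ(t,0) = (∏_{k=0}^{t−1} λ(k))·(1/3)J and ‖Φ(t,0)‖ = ∏_{k=0}^{t−1}(1 − 1/(k+2)²), and ‖Φ(t,0)‖ → 1/2 as t → ∞. In particular ‖Φ(t,0)‖ does not converge to 0, so the system is not asymptotically stable even though every agent is stubborn (λ_i(t) < 1) and the interaction graph is complete at every time step. -/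
open Matrix Finset Filter

noncomputable section

/-- Susceptibility `λ(t) = 1 − 1/(t+2)²` of the counterexample. -/
noncomputable def lam17 : ℕ → Fin 3 → ℝ := fun t _ => 1 - 1 / ((t : ℝ) + 2) ^ 2

/-- Influence matrix `W = (1/3)·J` (`J` the all-ones `3×3` matrix). -/
noncomputable def W17 : ℕ → Matrix (Fin 3) (Fin 3) ℝ := fun _ => Matrix.of fun _ _ => (1 : ℝ) / 3

/-- Any product of the matrices `λ(k)·(1/3)J`, `k < t`, with at least one factor is a multiple of
`(1/3)J`, because `(1/3)J` is idempotent. -/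
theorem Phi_lam17_W17_eq_smul (t : ℕ) (ht : 1 ≤ t) :
    Phi lam17 W17 t 0 =
      (∏ k ∈ Finset.range t, (1 - 1 / ((k : ℝ) + 2) ^ 2)) • W17 0 := by
  induction t, ht using Nat.le_induction with
  | base =>
    ext i j
    simp [Phi, PhiAux, lam17, W17]
  | succ t _ ih =>
    have hstep : Phi lam17 W17 (t + 1) 0 =
        (Matrix.diagonal (lam17 t) * W17 t) * Phi lam17 W17 t 0 := by
      simp [Phi, PhiAux]
    rw [hstep, ih, Finset.prod_range_succ]
    ext i j
    rw [Matrix.mul_apply]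
    simp only [Matrix.diagonal_mul, Matrix.smul_apply, lam17, W17, Matrix.of_apply,
      Fin.sum_univ_three, smul_eq_mul]
    ring

/-- The telescoping product `∏_{k<t} (1 − 1/(k+2)²)` in closed form. -/
theorem prod_one_sub_inv_sq_eq (t : ℕ) :
    ∏ k ∈ Finset.range t, (1 - 1 / ((k : ℝ) + 2) ^ 2) =
      1 / 2 + 1 / 2 * (1 / ((t : ℝ) + 1)) := by
  induction t with
  | zero => norm_num
  | succ t ih =>
    have h₁ : (t : ℝ) + 1 ≠ 0 := by positivity
    have h₂ : (t : ℝ) + 2 ≠ 0 := by positivity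
    have h₃ : (t : ℝ) + 1 + 1 ≠ 0 := by positivity
    rw [Finset.prod_range_succ, ih]
    push_cast
    field_simp
    ring

theorem rowNorm_smul_W17 {c : ℝ} (hc : 0 ≤ c) : rowNorm (c • W17 0) = c := by
  have hrow : ∀ i : Fin 3, ∑ j, |(c • W17 0) i j| = c := fun i => by
    simp only [Matrix.smul_apply, W17, Matrix.of_apply, smul_eq_mul, Fin.sum_univ_three]
    rw [abs_of_nonneg (by positivity)]
    ring
  simp only [rowNorm, hrow, ciSup_const]

theorem rowNorm_Phi_lam17_W17 (t : ℕ) (ht : 1 ≤ t) :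
    rowNorm (Phi lam17 W17 t 0) =
      ∏ k ∈ Finset.range t, (1 - 1 / ((k : ℝ) + 2) ^ 2) := by
  rw [Phi_lam17_W17_eq_smul t ht]
  refine rowNorm_smul_W17 ?_
  rw [prod_one_sub_inv_sq_eq]
  positivity

theorem tendsto_rowNorm_Phi_lam17_W17 :
    Filter.Tendsto (fun t => rowNorm (Phi lam17 W17 t 0)) Filter.atTop (nhds (1 / 2)) := by
  have hlim : Filter.Tendsto (fun t : ℕ => (1 / 2 : ℝ) + 1 / 2 * (1 / ((t : ℝ) + 1)))
      Filter.atTop (nhds (1 / 2)) := by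
    simpa using (tendsto_one_div_add_atTop_nhds_zero_nat (𝕜 := ℝ)).const_mul (1 / 2 : ℝ)
      |>.const_add (1 / 2 : ℝ)
  refine hlim.congr' ?_
  filter_upwards [Filter.eventually_ge_atTop 1] with t ht
  rw [rowNorm_Phi_lam17_W17 t ht, prod_one_sub_inv_sq_eq]

/-- counterexample with `n = 3`, `W = (1/3)·J` and
`Λ(t) = (1 − 1/(t+2)²)·I`: all agents are stubborn and the graph is complete at
every step, yet `Φ(t,0) = (∏_{k<t} λ(k))·(1/3)J`,
`‖Φ(t,0)‖ = ∏_{k<t}(1 − 1/(k+2)²) → 1/2 ≠ 0`, so the system is not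
asymptotically stable. -/
theorem wdtg_not_sufficient_counterexample :
    (∀ t : ℕ, ∀ i : Fin 3, lam17 t i < 1) ∧
    (∀ t : ℕ, ∀ i j : Fin 3, 0 < W17 t i j) ∧
    (∀ t : ℕ, 1 ≤ t →
      Phi lam17 W17 t 0 =
        (∏ k ∈ Finset.range t, (1 - 1 / ((k : ℝ) + 2) ^ 2)) • W17 0) ∧
    (∀ t : ℕ, 1 ≤ t →
      rowNorm (Phi lam17 W17 t 0) =
        ∏ k ∈ Finset.range t, (1 - 1 / ((k : ℝ) + 2) ^ 2)) ∧
    Filter.Tendsto (fun t => rowNorm (Phi lam17 W17 t 0)) Filter.atTop (nhds (1 / 2)) ∧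
    ¬ Filter.Tendsto (fun t => rowNorm (Phi lam17 W17 t 0)) Filter.atTop (nhds 0) := by
  refine ⟨fun t i => ?_, fun t i j => ?_, Phi_lam17_W17_eq_smul, rowNorm_Phi_lam17_W17,
    tendsto_rowNorm_Phi_lam17_W17, fun h => ?_⟩
  · have : 0 < 1 / ((t : ℝ) + 2) ^ 2 := by positivity
    simp only [lam17]
    linarith
  · norm_num [W17]
  · exact absurd (tendsto_nhds_unique tendsto_rowNorm_Phi_lam17_W17 h) (by norm_num)
end
end
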